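/- arXiv:2101.11312 — 2 statements merged into one kernel-verified Lean document; each statement's English description precedes it below -/
import Mathlib

section
/- ⟨m⟩ dominance (Corollary 2). Let A : Bool → Matrix (Fin n) (Fin n) ℝ assign a dynamics matrix to hits (true) and misses (false). Let m, k ∈ ℕ with k > m ≥ 0 and k ≥ 1. Then ρ(A, S(m,k)) ≤ ρ(A, S(⟨m⟩)), where S(m,k) is the set of infinite Boolean sequences satisfying the weakly-hard constraint (m,k) and S(⟨m⟩) is the set of infinite Boolean sequences never having m+1 consecutive misses. -/
/-- Frobenius norm of a real `n × n` matrix. -/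
noncomputable def frob {n : ℕ} (A : Matrix (Fin n) (Fin n) ℝ) : ℝ :=
  Real.sqrt (∑ i, ∑ j, (A i j) ^ 2)

/-- Ordered product `A (α (ℓ-1)) * ⋯ * A (α 1) * A (α 0)` along the first `ℓ`
letters of the infinite word `α`. -/
noncomputable def wordProd {Γ : Type*} {n : ℕ} (A : Γ → Matrix (Fin n) (Fin n) ℝ)
    (α : ℕ → Γ) : ℕ → Matrix (Fin n) (Fin n) ℝ
  | 0 => 1
  | ℓ + 1 => A (α ℓ) * wordProd A α ℓ

/-- Constrained joint spectral radius of the family `A` along the set `S`. -/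
noncomputable def cjsr {Γ : Type*} {n : ℕ} (A : Γ → Matrix (Fin n) (Fin n) ℝ)
    (S : Set (ℕ → Γ)) : ℝ :=
  Filter.limsup
    (fun ℓ : ℕ => sSup {r : ℝ | ∃ α ∈ S, r = frob (wordProd A α ℓ) ^ ((1 : ℝ) / (ℓ : ℝ))})
    Filter.atTop

/-- `α` satisfies the weakly-hard constraint `(m, k)`: in every window of `k`
consecutive activations there are at most `m` misses (`false`). -/
def WHmk (m k : ℕ) (α : ℕ → Bool) : Prop :=
  ∀ i : ℕ, ((Finset.Ico i (i + k)).filter fun j => α j = false).card ≤ m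

/-- `α` satisfies the consecutive-miss constraint `⟨m⟩`: there is no run of
`m + 1` consecutive misses. -/
def WHcons (m : ℕ) (α : ℕ → Bool) : Prop :=
  ¬ ∃ i : ℕ, ∀ j ∈ Finset.Ico i (i + (m + 1)), α j = false

theorem frob_eq_frobenius_norm {n : ℕ} (A : Matrix (Fin n) (Fin n) ℝ) :
    frob A = @norm _ Matrix.frobeniusNormedAddCommGroup.toNorm A := by
  rw [Matrix.frobenius_norm_def, frob, Real.sqrt_eq_rpow]
  simp

theorem frob_nonneg {n : ℕ} (A : Matrix (Fin n) (Fin n) ℝ) : 0 ≤ frob A :=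
  Real.sqrt_nonneg _

theorem frob_mul_le {n : ℕ} (A B : Matrix (Fin n) (Fin n) ℝ) :
    frob (A * B) ≤ frob A * frob B := by
  simp only [frob_eq_frobenius_norm]
  exact Matrix.frobenius_norm_mul A B

theorem frob_wordProd_le {Γ : Type*} {n : ℕ} {A : Γ → Matrix (Fin n) (Fin n) ℝ} {M : ℝ}
    (h_one : frob (1 : Matrix (Fin n) (Fin n) ℝ) ≤ M) (hA : ∀ g, frob (A g) ≤ M)
    (α : ℕ → Γ) (ℓ : ℕ) : frob (wordProd A α ℓ) ≤ M ^ (ℓ + 1) := by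
  induction ℓ with
  | zero => simpa [wordProd] using h_one
  | succ ℓ ih =>
    calc frob (A (α ℓ) * wordProd A α ℓ)
        ≤ frob (A (α ℓ)) * frob (wordProd A α ℓ) := frob_mul_le _ _
      _ ≤ M * M ^ (ℓ + 1) :=
        mul_le_mul (hA _) ih (frob_nonneg _) ((frob_nonneg _).trans h_one)
      _ = M ^ (ℓ + 1 + 1) := by ring

theorem exists_frob_wordProd_rpow_le {Γ : Type*} [Finite Γ] {n : ℕ}
    (A : Γ → Matrix (Fin n) (Fin n) ℝ) :
    ∃ C : ℝ, 0 ≤ C ∧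
      ∀ (α : ℕ → Γ) (ℓ : ℕ), frob (wordProd A α ℓ) ^ ((1 : ℝ) / (ℓ : ℝ)) ≤ C := by
  obtain ⟨K, hK⟩ := (Set.finite_range fun g => frob (A g)).bddAbove
  set M : ℝ := max 1 (max (frob (1 : Matrix (Fin n) (Fin n) ℝ)) K)
  have hM : 1 ≤ M := le_max_left _ _
  have h_one : frob (1 : Matrix (Fin n) (Fin n) ℝ) ≤ M :=
    (le_max_left _ _).trans (le_max_right _ _)
  have hA : ∀ g, frob (A g) ≤ M := fun g =>
    (hK ⟨g, rfl⟩).trans ((le_max_right _ _).trans (le_max_right _ _))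
  refine ⟨M ^ 2, by positivity, fun α ℓ => ?_⟩
  rcases Nat.eq_zero_or_pos ℓ with rfl | hℓ
  · rw [Nat.cast_zero, div_zero, Real.rpow_zero]
    exact one_le_pow₀ hM
  · calc frob (wordProd A α ℓ) ^ ((1 : ℝ) / (ℓ : ℝ))
        ≤ ((M ^ 2) ^ ℓ) ^ ((1 : ℝ) / (ℓ : ℝ)) := by
          refine Real.rpow_le_rpow (frob_nonneg _) ?_ (by positivity)
          refine (frob_wordProd_le h_one hA α ℓ).trans ?_
          rw [← pow_mul]
          exact pow_le_pow_right₀ hM (by omega)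
      _ = M ^ 2 := by
          rw [one_div]
          exact Real.pow_rpow_inv_natCast (by positivity) hℓ.ne'

theorem cjsr_mono {Γ : Type*} [Finite Γ] {n : ℕ} (A : Γ → Matrix (Fin n) (Fin n) ℝ)
    {S T : Set (ℕ → Γ)} (hST : S ⊆ T) : cjsr A S ≤ cjsr A T := by
  obtain ⟨C, hC, hbound⟩ := exists_frob_wordProd_rpow_le A
  have h_nonneg : ∀ (U : Set (ℕ → Γ)) (ℓ : ℕ),
      0 ≤ sSup {r : ℝ | ∃ α ∈ U, r = frob (wordProd A α ℓ) ^ ((1 : ℝ) / (ℓ : ℝ))} := by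
    rintro U ℓ
    refine Real.sSup_nonneg ?_
    rintro _ ⟨α, -, rfl⟩
    exact Real.rpow_nonneg (frob_nonneg _) _
  refine Filter.limsup_le_limsup (Filter.Eventually.of_forall fun ℓ => ?_) ?_ ?_
  · refine Real.sSup_le ?_ (h_nonneg T ℓ)
    rintro _ ⟨α, hα, rfl⟩
    refine le_csSup ⟨C, ?_⟩ ⟨α, hST hα, rfl⟩
    rintro _ ⟨β, -, rfl⟩
    exact hbound β ℓ
  · exact (Filter.isBoundedUnder_of ⟨0, h_nonneg S⟩).isCoboundedUnder_le
  · refine Filter.isBoundedUnder_of ⟨C, fun ℓ => Real.sSup_le ?_ hC⟩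
    rintro _ ⟨α, -, rfl⟩
    exact hbound α ℓ

theorem WHmk.whCons {m k : ℕ} (hmk : m < k) {α : ℕ → Bool} (hα : WHmk m k α) :
    WHcons m α := by
  rintro ⟨i, hi⟩
  have hsub : Finset.Ico i (i + (m + 1)) ⊆
      (Finset.Ico i (i + k)).filter fun j => α j = false := fun j hj =>
    Finset.mem_filter.2 ⟨Finset.Ico_subset_Ico_right (by omega) hj, hi j hj⟩
  have hcard := (Finset.card_le_card hsub).trans (hα i)
  rw [Nat.card_Ico] at hcard
  omega

/-- **`⟨m⟩` dominance (Corollary 2).** For `k > m` (and `k ≥ 1`),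
`ρ(A, S(m,k)) ≤ ρ(A, S(⟨m⟩))`. -/
theorem cons_dominance {n : ℕ} (A : Bool → Matrix (Fin n) (Fin n) ℝ)
    (m k : ℕ) (hmk : m < k) (hk : 1 ≤ k) :
    cjsr A {α | WHmk m k α} ≤ cjsr A {α | WHcons m α} := by
  exact cjsr_mono A fun _ hα => WHmk.whCons hmk hα
end

section
/- JSR upper bound from a positive homogeneous polynomial (Theorem 1, after Parrilo–Jadbabaie). Let A₁, …, A_ℓ : Matrix (Fin n) (Fin n) ℝ, let d ≥ 1, let γ > 0, and let p be a multivariate real polynomial in n variables that is homogeneous of degree 2d and satisfies p(x) > 0 for all x ∈ ℝⁿ with x ≠ 0. Suppose that for every x ∈ ℝⁿ and every i ∈ {1, …, ℓ}, γ^{2d} · p(x) − p(A_i.mulVec x) ≥ 0. Then the joint spectral radius satisfies ρ(A₁,…,A_ℓ) ≤ γ, i.e., limsup_{k→∞} max_{α ∈ {1,…,ℓ}^k} ‖A_{α_k} ⋯ A_{α_2} A_{α_1}‖^{1/k} ≤ γ, where ‖·‖ is the Frobenius norm. -/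
/-- Joint spectral radius of the finite family `A₁, …, A_ℓ`:
`limsup_{k→∞} max_{α ∈ {1,…,ℓ}^k} ‖A_{α_k} ⋯ A_{α_1}‖^{1/k}` (Frobenius
norm). -/
noncomputable def jsr {ℓ n : ℕ} (A : Fin ℓ → Matrix (Fin n) (Fin n) ℝ) : ℝ :=
  Filter.limsup
    (fun k : ℕ =>
      sSup {r : ℝ | ∃ α : ℕ → Fin ℓ, r = frob (wordProd A α k) ^ ((1 : ℝ) / (k : ℝ))})
    Filter.atTop

/-- Scaling law for the evaluation of a homogeneous polynomial. -/
theorem MvPolynomial.IsHomogeneous.eval_smul_pow {σ R : Type*} [CommSemiring R]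
    {p : MvPolynomial σ R} {m : ℕ} (hp : p.IsHomogeneous m) (c : R) (x : σ → R) :
    MvPolynomial.eval (c • x) p = c ^ m * MvPolynomial.eval x p := by
  rw [MvPolynomial.eval_eq, MvPolynomial.eval_eq, Finset.mul_sum]
  refine Finset.sum_congr rfl fun e he => ?_
  have hdeg : ∑ i ∈ e.support, e i = m := by
    have h := hp (MvPolynomial.mem_support_iff.mp he)
    simpa [Finsupp.weight_apply, Finsupp.sum] using h
  simp only [Pi.smul_apply, smul_eq_mul, mul_pow, Finset.prod_mul_distrib]
  rw [Finset.prod_pow_eq_pow_sum, hdeg]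
  ring

/-- A homogeneous polynomial that is positive away from the origin dominates a positive multiple
of the corresponding power of the norm. -/
theorem MvPolynomial.IsHomogeneous.exists_norm_pow_le_eval {n m : ℕ} (hn : 1 ≤ n) (hm : m ≠ 0)
    {p : MvPolynomial (Fin n) ℝ} (hp : p.IsHomogeneous m)
    (hpos : ∀ x : Fin n → ℝ, x ≠ 0 → 0 < MvPolynomial.eval x p) :
    ∃ c : ℝ, 0 < c ∧ ∀ x : Fin n → ℝ, c * ‖x‖ ^ m ≤ MvPolynomial.eval x p := by
  have : Nonempty (Fin n) := ⟨⟨0, hn⟩⟩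
  obtain ⟨y, hy, hmin⟩ := (isCompact_sphere (0 : Fin n → ℝ) 1).exists_isMinOn
    (NormedSpace.sphere_nonempty.mpr zero_le_one) (MvPolynomial.continuous_eval p).continuousOn
  have hy0 : y ≠ 0 := by
    rintro rfl
    simp at hy
  refine ⟨MvPolynomial.eval y p, hpos y hy0, fun x => ?_⟩
  rcases eq_or_ne x 0 with rfl | hx
  · have h := hp.eval_smul_pow 0 (0 : Fin n → ℝ)
    rw [zero_smul, zero_pow hm, zero_mul] at h
    rw [h, norm_zero, zero_pow hm, mul_zero]
  · have hx' : ‖x‖ ≠ 0 := norm_ne_zero_iff.mpr hx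
    have hmem : ‖x‖⁻¹ • x ∈ Metric.sphere (0 : Fin n → ℝ) 1 := by
      simp [norm_smul, hx']
    have hle : MvPolynomial.eval y p ≤ MvPolynomial.eval (‖x‖⁻¹ • x) p := hmin hmem
    calc MvPolynomial.eval y p * ‖x‖ ^ m
        ≤ MvPolynomial.eval (‖x‖⁻¹ • x) p * ‖x‖ ^ m := by gcongr
      _ = MvPolynomial.eval x p := by
        rw [mul_comm, ← hp.eval_smul_pow, smul_inv_smul₀ hx']

/-- A function contracted by a factor `c` along each matrix of a family is contracted by `c ^ k`
along words of length `k`. -/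
theorem map_wordProd_mulVec_le {Γ : Type*} {n : ℕ} {A : Γ → Matrix (Fin n) (Fin n) ℝ}
    {f : (Fin n → ℝ) → ℝ} {c : ℝ} (hc : 0 ≤ c)
    (h : ∀ x i, f ((A i).mulVec x) ≤ c * f x) (α : ℕ → Γ) (x : Fin n → ℝ) (k : ℕ) :
    f ((wordProd A α k).mulVec x) ≤ c ^ k * f x := by
  induction k with
  | zero => simp [wordProd]
  | succ k ih =>
    rw [wordProd, ← Matrix.mulVec_mulVec, pow_succ', mul_assoc]
    exact (h _ _).trans (mul_le_mul_of_nonneg_left ih hc)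

/-- The Frobenius norm is at most `n` times any bound on the absolute values of the entries. -/
theorem frob_le_of_abs_le {n : ℕ} {A : Matrix (Fin n) (Fin n) ℝ} {b : ℝ} (hb : 0 ≤ b)
    (h : ∀ i j, |A i j| ≤ b) : frob A ≤ n * b := by
  refine Real.sqrt_le_iff.mpr ⟨by positivity, ?_⟩
  calc ∑ i, ∑ j, A i j ^ 2 ≤ ∑ _i : Fin n, ∑ _j : Fin n, b ^ 2 :=
        Finset.sum_le_sum fun i _ => Finset.sum_le_sum fun j _ =>
          sq_le_sq' (abs_le.mp (h i j)).1 (abs_le.mp (h i j)).2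
    _ = (n * b) ^ 2 := by simp; ring

/-- A geometric bound on all word products bounds the joint spectral radius. -/
theorem jsr_le_of_frob_wordProd_le {n ℓ : ℕ} {A : Fin ℓ → Matrix (Fin n) (Fin n) ℝ}
    {C γ : ℝ} (hC : 0 < C) (hγ : 0 ≤ γ)
    (h : ∀ α k, frob (wordProd A α k) ≤ C * γ ^ k) : jsr A ≤ γ := by
  have hlim : Filter.Tendsto (fun k : ℕ => C ^ ((1 : ℝ) / (k : ℝ)) * γ) Filter.atTop
      (nhds γ) := by
    have h1 := (Real.continuousAt_const_rpow (b := 0) hC.ne').tendsto.comp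
      tendsto_one_div_atTop_nhds_zero_nat
    simpa [Function.comp_def] using h1.mul_const γ
  rw [jsr, ← hlim.limsup_eq]
  refine Filter.limsup_le_limsup ?_ ?_ hlim.isBoundedUnder_le
  · filter_upwards [Filter.eventually_gt_atTop 0] with k hk
    refine Real.sSup_le ?_ (by positivity)
    rintro r ⟨α, rfl⟩
    calc frob (wordProd A α k) ^ ((1 : ℝ) / (k : ℝ))
        ≤ (C * γ ^ k) ^ ((1 : ℝ) / (k : ℝ)) :=
          Real.rpow_le_rpow (Real.sqrt_nonneg _) (h α k) (by positivity)
      _ = C ^ ((1 : ℝ) / (k : ℝ)) * γ := by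
          rw [Real.mul_rpow hC.le (by positivity), one_div, Real.pow_rpow_inv_natCast hγ hk.ne']
  · refine Filter.isCoboundedUnder_le_of_le (x := 0) Filter.atTop fun k => Real.sSup_nonneg ?_
    rintro r ⟨α, rfl⟩
    exact Real.rpow_nonneg (Real.sqrt_nonneg _) _

/-- **JSR upper bound from a positive homogeneous polynomial (Theorem 1,
after Parrilo–Jadbabaie).** If `p` is homogeneous of degree `2d`, strictly
positive away from the origin, and `γ^{2d} p(x) - p(Aᵢ x) ≥ 0` for all `x` and
all `i`, then `ρ(A₁, …, A_ℓ) ≤ γ`. -/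
theorem jsr_le_of_homogeneous_poly {n ℓ d : ℕ} (hn : 1 ≤ n) (hℓ : 1 ≤ ℓ)
    (hd : 1 ≤ d) (A : Fin ℓ → Matrix (Fin n) (Fin n) ℝ) (γ : ℝ) (hγ : 0 < γ)
    (p : MvPolynomial (Fin n) ℝ) (hhom : p.IsHomogeneous (2 * d))
    (hpos : ∀ x : Fin n → ℝ, x ≠ 0 → 0 < MvPolynomial.eval x p)
    (hdec : ∀ (x : Fin n → ℝ) (i : Fin ℓ),
      0 ≤ γ ^ (2 * d) * MvPolynomial.eval x p -
        MvPolynomial.eval ((A i).mulVec x) p) :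
    jsr A ≤ γ := by
  have : Nonempty (Fin n) := ⟨⟨0, hn⟩⟩
  obtain ⟨c, hc, hlow⟩ := hhom.exists_norm_pow_le_eval hn (by omega) hpos
  obtain ⟨M, hM⟩ := (Set.finite_range
    fun j : Fin n => MvPolynomial.eval (Pi.single j (1 : ℝ)) p).bddAbove
  set K : ℝ := max 1 (M / c)
  have hK : 1 ≤ K := le_max_left _ _
  have hMK : M ≤ c * K := (div_le_iff₀' hc).mp (le_max_right _ _)
  have hentry : ∀ (α : ℕ → Fin ℓ) (k : ℕ) (i j : Fin n),
      |wordProd A α k i j| ≤ K * γ ^ k := by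
    intro α k i j
    set v := (wordProd A α k).mulVec (Pi.single j 1)
    have hv : c * ‖v‖ ^ (2 * d) ≤ c * (K * γ ^ k) ^ (2 * d) := calc
      c * ‖v‖ ^ (2 * d) ≤ MvPolynomial.eval v p := hlow v
      _ ≤ (γ ^ (2 * d)) ^ k * MvPolynomial.eval (Pi.single j 1) p :=
        map_wordProd_mulVec_le (f := fun x => MvPolynomial.eval x p) (by positivity)
          (fun x i => sub_nonneg.mp (hdec x i)) α _ k
      _ ≤ (γ ^ (2 * d)) ^ k * (c * K ^ (2 * d)) := by
        gcongr
        refine ((hM ⟨j, rfl⟩).trans hMK).trans ?_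
        gcongr
        exact le_self_pow₀ hK (by omega)
      _ = c * (K * γ ^ k) ^ (2 * d) := by rw [mul_pow, pow_right_comm]; ring
    have hnorm : ‖v‖ ≤ K * γ ^ k :=
      le_of_pow_le_pow_left₀ (by omega) (by positivity) (le_of_mul_le_mul_left hv hc)
    have hvi : v i = wordProd A α k i j := by simp [v]
    rw [← hvi]
    exact (norm_le_pi_norm v i).trans hnorm
  refine jsr_le_of_frob_wordProd_le (C := n * K) (by positivity) hγ.le fun α k => ?_
  rw [mul_assoc]
  exact frob_le_of_abs_le (by positivity) (hentry α k)
end
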